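/- Let n ≥ 1. An invertible real n×n matrix M commutes with the induced map of every semilinear continuous function f : ℝ → ℝ if and only if M is a non-negative monomial matrix; and a continuous function f : ℝ → ℝ commutes with every n×n non-negative monomial matrix if and only if f is semilinear. Equivalently, 𝓜(semilinear functions) is exactly the set of non-negative monomial matrices, and 𝓕(non-negative monomial matrices) is exactly the set of semilinear functions. -/

import Mathlib

/-- The coordinatewise induced map `f̃ : ℝⁿ → ℝⁿ` of `f : ℝ → ℝ`. -/
def inducedMap (n : ℕ) (f : ℝ → ℝ) : (Fin n → ℝ) → (Fin n → ℝ) :=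
  fun v i => f (v i)

/-- `f` commutes with the matrix `M`: `f̃(Mv) = M f̃(v)` for all `v`. -/
def CommutesWith (n : ℕ) (f : ℝ → ℝ) (M : Matrix (Fin n) (Fin n) ℝ) : Prop :=
  ∀ v : Fin n → ℝ, inducedMap n f (M.mulVec v) = M.mulVec (inducedMap n f v)

/-- `𝓜(𝓕)`: the set of invertible `n×n` real matrices commuting with every `f ∈ 𝓕`. -/
def Mop (n : ℕ) (F : Set (ℝ → ℝ)) : Set (Matrix (Fin n) (Fin n) ℝ) :=
  {M | IsUnit M ∧ ∀ f ∈ F, CommutesWith n f M}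

/-- `𝓕(𝓜)`: the set of continuous functions `ℝ → ℝ` commuting with every `M ∈ 𝓜`. -/
def Fop (n : ℕ) (Ms : Set (Matrix (Fin n) (Fin n) ℝ)) : Set (ℝ → ℝ) :=
  {f | Continuous f ∧ ∀ M ∈ Ms, CommutesWith n f M}

/-- A matrix is monomial if every row and every column contains exactly one nonzero entry. -/
def IsMonomial {n : ℕ} (M : Matrix (Fin n) (Fin n) ℝ) : Prop :=
  (∀ i, ∃! j, M i j ≠ 0) ∧ (∀ j, ∃! i, M i j ≠ 0)

/-- A non-negative monomial matrix: monomial with all nonzero entries positive. -/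
def IsNonnegMonomial {n : ℕ} (M : Matrix (Fin n) (Fin n) ℝ) : Prop :=
  IsMonomial M ∧ ∀ i j, M i j ≠ 0 → 0 < M i j

/-- `f` is semilinear: `f(x) = f(1)·x` for `x ≥ 0` and `f(x) = -f(-1)·x` for `x ≤ 0`. -/
def Semilinear (f : ℝ → ℝ) : Prop :=
  (∀ x : ℝ, 0 ≤ x → f x = f 1 * x) ∧ (∀ x : ℝ, x ≤ 0 → f x = -f (-1) * x)

theorem row_mulVec {n : ℕ} {M : Matrix (Fin n) (Fin n) ℝ} (i j : Fin n)
    (h : ∀ k, M i k ≠ 0 → k = j) (v : Fin n → ℝ) : M.mulVec v i = M i j * v j := by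
  rw [Matrix.mulVec, dotProduct]
  refine Finset.sum_eq_single j (fun k _ hk => ?_) (fun hj => absurd (Finset.mem_univ j) hj)
  by_cases h0 : M i k = 0
  · rw [h0, zero_mul]
  · exact absurd (h k h0) hk

theorem semilinear_hom {f : ℝ → ℝ} (hf : Semilinear f) {c : ℝ} (hc : 0 < c) (x : ℝ) :
    f (c * x) = c * f x := by
  rcases le_total 0 x with hx | hx
  · rw [hf.1 x hx, hf.1 (c * x) (mul_nonneg hc.le hx)]; ring
  · rw [hf.2 x hx, hf.2 (c * x) (mul_nonpos_of_nonneg_of_nonpos hc.le hx)]; ring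

theorem monomial_commutes {n : ℕ} {M : Matrix (Fin n) (Fin n) ℝ} (hM : IsNonnegMonomial M)
    {f : ℝ → ℝ} (hf : Semilinear f) : CommutesWith n f M := by
  intro v
  funext i
  obtain ⟨j, hj, hu⟩ := hM.1.1 i
  rw [row_mulVec i j hu]
  show f (M.mulVec v i) = M i j * f (v j)
  rw [row_mulVec i j hu, semilinear_hom hf (hM.2 i j hj)]

theorem monomial_isUnit {n : ℕ} {M : Matrix (Fin n) (Fin n) ℝ} (hM : IsNonnegMonomial M) :
    IsUnit M := by
  rw [← Matrix.mulVec_injective_iff_isUnit]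
  intro v w hvw
  funext j
  obtain ⟨i, hi, -⟩ := hM.1.2 j
  have hu : ∀ k, M i k ≠ 0 → k = j := fun k hk => (hM.1.1 i).unique hk hi
  have h : M.mulVec v i = M.mulVec w i := congrFun hvw i
  rw [row_mulVec i j hu, row_mulVec i j hu] at h
  exact mul_left_cancel₀ hi h

theorem relu_semilinear : Semilinear (fun x : ℝ => max x 0) := by
  constructor
  · intro x hx
    simp [hx]
  · intro x hx
    simp [hx]

theorem commutes_relu {n : ℕ} {M : Matrix (Fin n) (Fin n) ℝ} (hU : IsUnit M)
    (h : CommutesWith n (fun x : ℝ => max x 0) M) : IsNonnegMonomial M := by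
  have hdet : M.det ≠ 0 := ((Matrix.isUnit_iff_isUnit_det M).1 hU).ne_zero
  have hnn : ∀ i j, 0 ≤ M i j := by
    intro i j
    have h1 := congrFun (h (Pi.single j 1)) i
    have h2 : inducedMap n (fun x : ℝ => max x 0) (Pi.single j 1) = Pi.single j 1 := by
      funext k
      by_cases hk : k = j
      · subst hk; simp [inducedMap]
      · simp [inducedMap, hk]
    rw [h2] at h1
    simp [inducedMap] at h1
    exact h1
  have hpos : ∀ i j, M i j ≠ 0 → 0 < M i j := fun i j hij => lt_of_le_of_ne (hnn i j) hij.symm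
  have huniq : ∀ i j k, M i j ≠ 0 → M i k ≠ 0 → j = k := by
    intro i j k hj hk
    by_contra hjk
    have h1 := congrFun (h (Pi.single j (M i k) - Pi.single k (M i j))) i
    have h2 : inducedMap n (fun x : ℝ => max x 0)
        (Pi.single j (M i k) - Pi.single k (M i j)) = Pi.single j (M i k) := by
      funext l
      by_cases hl : l = j
      · subst hl; simp [inducedMap, hjk, hnn]
      · by_cases hl' : l = k
        · subst hl'; simp [inducedMap, hl, hnn]
        · simp [inducedMap, hl, hl']
    rw [h2] at h1
    have h3 : M.mulVec (Pi.single j (M i k) - Pi.single k (M i j)) i = 0 := by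
      rw [Matrix.mulVec_sub]
      simp [mul_comm]
    have h4 : M.mulVec (Pi.single j (M i k)) i = M i j * M i k := by
      simp [mul_comm]
    rw [h4] at h1
    simp only [inducedMap, h3, max_self] at h1
    exact mul_ne_zero hj hk h1.symm
  have hrow : ∀ i, ∃ j, M i j ≠ 0 := by
    intro i
    by_contra! hc
    exact hdet (Matrix.det_eq_zero_of_row_eq_zero i hc)
  have hcol : ∀ j, ∃ i, M i j ≠ 0 := by
    intro j
    by_contra! hc
    exact hdet (Matrix.det_eq_zero_of_column_eq_zero j hc)
  choose σ hσ using hrow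
  have hsurj : Function.Surjective σ := by
    intro j
    obtain ⟨i, hi⟩ := hcol j
    exact ⟨i, huniq i _ _ (hσ i) hi⟩
  have hinj : Function.Injective σ := Finite.injective_iff_surjective.2 hsurj
  refine ⟨⟨fun i => ⟨σ i, hσ i, fun k hk => huniq i _ _ hk (hσ i)⟩, fun j => ?_⟩, hpos⟩
  obtain ⟨i, hi⟩ := hcol j
  refine ⟨i, hi, fun k hk => hinj ?_⟩
  rw [huniq k _ _ (hσ k) hk, huniq i _ _ (hσ i) hi]

theorem scalar_monomial {n : ℕ} {c : ℝ} (hc : 0 < c) :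
    IsNonnegMonomial (Matrix.diagonal (fun _ : Fin n => c)) := by
  have key : ∀ i j : Fin n, Matrix.diagonal (fun _ : Fin n => c) i j ≠ 0 ↔ i = j := by
    intro i j
    by_cases hij : i = j
    · subst hij; simp [hc.ne']
    · simp [hij]
  refine ⟨⟨fun i => ⟨i, (key i i).2 rfl, fun k hk => ((key i k).1 hk).symm⟩,
    fun j => ⟨j, (key j j).2 rfl, fun k hk => (key k j).1 hk⟩⟩, fun i j hij => ?_⟩
  obtain rfl := (key i j).1 hij
  simpa using hc

theorem fop_semilinear {n : ℕ} (hn : 1 ≤ n) {f : ℝ → ℝ}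
    (h : ∀ M : Matrix (Fin n) (Fin n) ℝ, IsNonnegMonomial M → CommutesWith n f M) :
    Semilinear f := by
  have hom : ∀ c : ℝ, 0 < c → ∀ x, f (c * x) = c * f x := by
    intro c hc x
    have h1 := congrFun (h _ (scalar_monomial hc) (fun _ => x)) ⟨0, hn⟩
    simpa [inducedMap, Matrix.mulVec_diagonal] using h1
  have h0 : f 0 = 0 := by
    have := hom 2 two_pos 0
    rw [mul_zero] at this
    linarith
  constructor
  · intro x hx
    rcases hx.eq_or_lt with rfl | hx
    · simp [h0]
    · have := hom x hx 1
      rw [mul_one] at this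
      rw [this, mul_comm]
  · intro x hx
    rcases hx.eq_or_lt with rfl | hx
    · simp [h0]
    · have := hom (-x) (by linarith) (-1)
      rw [neg_mul_neg, mul_one] at this
      rw [this]; ring

/-- `𝓜(semilinear functions)` is exactly the set of non-negative monomial matrices and
`𝓕(non-negative monomial matrices)` is exactly the set of (continuous) semilinear functions. -/
theorem stmt_5 (n : ℕ) (hn : 1 ≤ n) :
    Mop n {f : ℝ → ℝ | Continuous f ∧ Semilinear f} = {M | IsNonnegMonomial M} ∧
    Fop n {M | IsNonnegMonomial M} = {f : ℝ → ℝ | Continuous f ∧ Semilinear f} := by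
  refine ⟨Set.ext fun M => ⟨fun h => ?_, fun h => ?_⟩, Set.ext fun f => ⟨fun h => ?_, fun h => ?_⟩⟩
  · exact commutes_relu h.1 (h.2 _ ⟨by fun_prop, relu_semilinear⟩)
  · exact ⟨monomial_isUnit h, fun f hf => monomial_commutes h hf.2⟩
  · exact ⟨h.1, fop_semilinear hn h.2⟩
  · exact ⟨h.1, fun M hM => monomial_commutes hM h.2⟩
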